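/- Let n ≥ 2 and let a(t,x) satisfy Assumption (A). Then there exist constants C > 0 and τ̄ > 0 such that for all t₀ ∈ ℝ, x, ξ ∈ ℝⁿ, λ ≥ 1 and all τ with |τ − t₀| ≤ τ̄, the Hamiltonian trajectory satisfies |x(τ; t₀, x, λξ) − x − (τ − t₀) λξ| + |ξ(τ; t₀, x, λξ) − λξ| ≤ C |τ − t₀| (1 + |x| + λ|ξ|). -/

import Mathlib

open MeasureTheory Complex Filter

noncomputable section

abbrev V (n : ℕ) := EuclideanSpace ℝ (Fin n)

/-- Japanese bracket power `⟨x⟩^s`. -/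
def jap {n : ℕ} (x : V n) (s : ℝ) : ℝ := (1 + ‖x‖ ^ 2) ^ (s / 2)

/-- Assumption (A) on the magnetic vector potential. -/
def AssumptionA {n : ℕ} (a : ℝ → V n → V n) (ρ : ℝ) : Prop :=
  ContDiff ℝ (⊤ : ℕ∞) (fun p : ℝ × V n => a p.1 p.2) ∧
  ∀ k : ℕ, ∃ C : ℝ, 0 < C ∧ ∀ t : ℝ, ∀ x : V n,
    ‖iteratedFDeriv ℝ k (a t) x‖ ≤ C * jap x (ρ - k)

/-- The Hamiltonian flow of `h(t,x,ξ) = |ξ - a(t,x)|²/2` with data `(x, ξ)` at time `t₀`. -/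
def IsHamFlow {n : ℕ} (a : ℝ → V n → V n) (t₀ : ℝ) (x ξ : V n) (X Ξ : ℝ → V n) : Prop :=
  X t₀ = x ∧ Ξ t₀ = ξ ∧ ∀ s : ℝ,
    HasDerivAt X (Ξ s - a s (X s)) s ∧
    HasDerivAt Ξ (ContinuousLinearMap.adjoint (fderiv ℝ (a s) (X s)) (Ξ s - a s (X s))) s

/-- Conic neighborhood of `ξ₀`. -/
def IsConicNbhd {n : ℕ} (Γ : Set (V n)) (ξ₀ : V n) : Prop :=
  IsOpen Γ ∧ ξ₀ ∈ Γ ∧ ∀ ξ ∈ Γ, ∀ c : ℝ, 0 < c → c • ξ ∈ Γ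

def msize {n : ℕ} (α : Fin n → ℕ) : ℕ := ∑ j, α j

/-- Gronwall estimate for the displacement of a curve whose speed grows at most linearly with
its position, forward in time. -/
lemma norm_sub_le_of_linear_growth_forward {E : Type*} [NormedAddCommGroup E] [NormedSpace ℝ E]
    {f f' : ℝ → E} {K t₀ τ : ℝ} (hK : 0 < K) (hf : ∀ s, HasDerivAt f (f' s) s)
    (hbound : ∀ s, ‖f' s‖ ≤ K * (1 + ‖f s‖)) (hle : t₀ ≤ τ) (hτ : K * (τ - t₀) ≤ 1) :
    ‖f τ - f t₀‖ ≤ 2 * K * (τ - t₀) * (1 + ‖f t₀‖) := by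
  have hderiv : ∀ s, HasDerivAt (fun s => f s - f t₀) (f' s) s := fun s => (hf s).sub_const _
  have hgron := norm_le_gronwallBound_of_norm_deriv_right_le
    (f := fun s => f s - f t₀) (f' := f') (δ := 0) (K := K) (ε := K * (1 + ‖f t₀‖))
    (a := t₀) (b := τ)
    (fun s _ => (hderiv s).continuousAt.continuousWithinAt)
    (fun s _ => (hderiv s).hasDerivWithinAt) (by simp)
    (fun s _ => by
      have htri : ‖f s‖ ≤ ‖f s - f t₀‖ + ‖f t₀‖ := by
        simpa using norm_add_le (f s - f t₀) (f t₀)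
      nlinarith [hbound s])
    τ ⟨hle, le_rfl⟩
  have hnonneg : 0 ≤ K * (τ - t₀) := mul_nonneg hK.le (sub_nonneg.2 hle)
  have hexp : Real.exp (K * (τ - t₀)) - 1 ≤ 2 * (K * (τ - t₀)) := by
    have h := Real.abs_exp_sub_one_le (x := K * (τ - t₀)) (by rwa [abs_of_nonneg hnonneg])
    rw [abs_of_nonneg hnonneg] at h
    exact (le_abs_self _).trans h
  rw [gronwallBound_of_K_ne_0 hK.ne', mul_div_cancel_left₀ _ hK.ne'] at hgron
  simp only [zero_mul, zero_add] at hgron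
  refine hgron.trans ?_
  nlinarith [norm_nonneg (f t₀)]

/-- Gronwall estimate for the displacement of a curve whose speed grows at most linearly with
its position. -/
lemma norm_sub_le_of_linear_growth {E : Type*} [NormedAddCommGroup E] [NormedSpace ℝ E]
    {f f' : ℝ → E} {K t₀ τ : ℝ} (hK : 0 < K) (hf : ∀ s, HasDerivAt f (f' s) s)
    (hbound : ∀ s, ‖f' s‖ ≤ K * (1 + ‖f s‖)) (hτ : K * |τ - t₀| ≤ 1) :
    ‖f τ - f t₀‖ ≤ 2 * K * |τ - t₀| * (1 + ‖f t₀‖) := by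
  rcases le_total t₀ τ with h | h
  · rw [abs_of_nonneg (sub_nonneg.2 h)] at hτ ⊢
    exact norm_sub_le_of_linear_growth_forward hK hf hbound h hτ
  · rw [abs_of_nonpos (sub_nonpos.2 h)] at hτ ⊢
    have hderiv : ∀ s, HasDerivAt (fun s => f (-s)) (-f' (-s)) s := fun s => by
      simpa [Function.comp_def] using (hf (-s)).scomp s (hasDerivAt_neg s)
    have := norm_sub_le_of_linear_growth_forward (t₀ := -t₀) (τ := -τ) hK hderiv
      (fun s => by simpa using hbound (-s)) (neg_le_neg h) (by linarith)
    simp only [neg_neg] at this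
    convert this using 3
    ring

lemma jap_le_one_add_norm {n : ℕ} (x : V n) {s : ℝ} (hs : s ≤ 1) : jap x s ≤ 1 + ‖x‖ := by
  have hbase : 1 ≤ 1 + ‖x‖ ^ 2 := by nlinarith [sq_nonneg ‖x‖]
  calc jap x s ≤ (1 + ‖x‖ ^ 2) ^ (1 / 2 : ℝ) :=
        Real.rpow_le_rpow_of_exponent_le hbase (by linarith)
    _ = √(1 + ‖x‖ ^ 2) := (Real.sqrt_eq_rpow _).symm
    _ ≤ 1 + ‖x‖ := Real.sqrt_le_iff.2 ⟨by positivity, by nlinarith [norm_nonneg x]⟩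

lemma jap_le_one {n : ℕ} (x : V n) {s : ℝ} (hs : s ≤ 0) : jap x s ≤ 1 :=
  Real.rpow_le_one_of_one_le_of_nonpos (by nlinarith [sq_nonneg ‖x‖]) (by linarith)

lemma AssumptionA.exists_norm_le {n : ℕ} {a : ℝ → V n → V n} {ρ : ℝ} (hA : AssumptionA a ρ)
    (hρ : ρ ≤ 1) : ∃ C, 0 < C ∧ ∀ t x, ‖a t x‖ ≤ C * (1 + ‖x‖) := by
  obtain ⟨C, hC, h⟩ := hA.2 0
  refine ⟨C, hC, fun t x => ?_⟩
  have hx := h t x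
  rw [norm_iteratedFDeriv_zero, Nat.cast_zero, sub_zero] at hx
  exact hx.trans (mul_le_mul_of_nonneg_left (jap_le_one_add_norm x hρ) hC.le)

lemma AssumptionA.exists_norm_fderiv_le {n : ℕ} {a : ℝ → V n → V n} {ρ : ℝ}
    (hA : AssumptionA a ρ) (hρ : ρ ≤ 1) : ∃ C, 0 < C ∧ ∀ t x, ‖fderiv ℝ (a t) x‖ ≤ C := by
  obtain ⟨C, hC, h⟩ := hA.2 1
  refine ⟨C, hC, fun t x => ?_⟩
  have hx := h t x
  rw [norm_iteratedFDeriv_one, Nat.cast_one] at hx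
  exact hx.trans (mul_le_of_le_one_right hC.le (jap_le_one x (by linarith)))

/-- **Short-time approximation of the flow** (Picard iteration byproduct):
`|x(τ) - x - (τ-t₀)λξ| + |ξ(τ) - λξ| ≤ C |τ-t₀| (1 + |x| + λ|ξ|)` for `|τ-t₀|` small. -/
theorem flow_short_time_approximation
    (n : ℕ) (hn : 2 ≤ n) (a : ℝ → V n → V n) (ρ : ℝ) (hρ : ρ < 1)
    (hA : AssumptionA a ρ) :
    ∃ C : ℝ, 0 < C ∧ ∃ τbar : ℝ, 0 < τbar ∧
      ∀ t₀ : ℝ, ∀ x ξ : V n, ∀ lam : ℝ, 1 ≤ lam →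
      ∀ τ : ℝ, |τ - t₀| ≤ τbar →
      ∀ X Ξ : ℝ → V n, IsHamFlow a t₀ x (lam • ξ) X Ξ →
        ‖X τ - x - (τ - t₀) • (lam • ξ)‖ + ‖Ξ τ - lam • ξ‖
          ≤ C * |τ - t₀| * (1 + ‖x‖ + lam * ‖ξ‖) := by
  obtain ⟨C₀, hC₀, ha⟩ := hA.exists_norm_le hρ.le
  obtain ⟨C₁, hC₁, hda⟩ := hA.exists_norm_fderiv_le hρ.le
  set K := (1 + C₁) * (1 + C₀) with hKdef
  have hK : 0 < K := by positivity
  refine ⟨4 * K + 1, by positivity, 1 / K, by positivity, ?_⟩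
  intro t₀ x ξ lam hlam τ hτ X Ξ ⟨hX, hΞ, hflow⟩
  have hvel : ∀ s, ‖Ξ s - a s (X s)‖ ≤ (1 + C₀) * (1 + ‖(X s, Ξ s)‖) := fun s => by
    have hX_le : ‖X s‖ ≤ ‖(X s, Ξ s)‖ := norm_fst_le (X s, Ξ s)
    have hΞ_le : ‖Ξ s‖ ≤ ‖(X s, Ξ s)‖ := norm_snd_le (X s, Ξ s)
    have hsub := norm_sub_le (Ξ s) (a s (X s))
    nlinarith [ha s (X s)]
  have hbound : ∀ s, ‖(Ξ s - a s (X s),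
      ContinuousLinearMap.adjoint (fderiv ℝ (a s) (X s)) (Ξ s - a s (X s)))‖
        ≤ K * (1 + ‖(X s, Ξ s)‖) := fun s => by
    have hforce := (ContinuousLinearMap.adjoint (fderiv ℝ (a s) (X s))).le_opNorm
      (Ξ s - a s (X s))
    rw [LinearIsometryEquiv.norm_map] at hforce
    have hforce_le := hforce.trans
      (mul_le_mul (hda s (X s)) (hvel s) (norm_nonneg _) hC₁.le)
    have hpos : 0 ≤ (1 + C₀) * (1 + ‖(X s, Ξ s)‖) := by positivity
    rw [hKdef, mul_assoc]
    refine max_le ?_ ?_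
    · exact (hvel s).trans (by nlinarith)
    · exact hforce_le.trans (by nlinarith)
  have hdisp := norm_sub_le_of_linear_growth (f := fun s => (X s, Ξ s)) (t₀ := t₀) (τ := τ) hK
    (fun s => (hflow s).1.prodMk (hflow s).2) hbound
    (by rwa [le_div_iff₀ hK, mul_comm] at hτ)
  simp only [hX, hΞ, Prod.mk_sub_mk] at hdisp
  have hnorm : ‖lam • ξ‖ = lam * ‖ξ‖ := by
    rw [norm_smul, Real.norm_of_nonneg (by linarith)]
  have hinit : ‖(x, lam • ξ)‖ ≤ ‖x‖ + lam * ‖ξ‖ := by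
    rw [← hnorm]
    exact max_le_add_of_nonneg (norm_nonneg _) (norm_nonneg _)
  have hXd := (norm_fst_le (X τ - x, Ξ τ - lam • ξ)).trans hdisp
  have hΞd := (norm_snd_le (X τ - x, Ξ τ - lam • ξ)).trans hdisp
  have hdrift : ‖(τ - t₀) • (lam • ξ)‖ ≤ |τ - t₀| * (1 + ‖x‖ + lam * ‖ξ‖) := by
    rw [norm_smul, hnorm, Real.norm_eq_abs]
    gcongr
    linarith [norm_nonneg x]
  have hsub := norm_sub_le (X τ - x) ((τ - t₀) • (lam • ξ))
  have hgrow : 2 * K * |τ - t₀| * (1 + ‖(x, lam • ξ)‖)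
      ≤ 2 * K * |τ - t₀| * (1 + ‖x‖ + lam * ‖ξ‖) :=
    mul_le_mul_of_nonneg_left (by linarith) (by positivity)
  simp only at hXd hΞd
  linarith

end
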